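/- Let g : ℂ → ℂ be a homeomorphism of the plane belonging to the local Sobolev space W^{1,2}_loc. For z ∈ ℂ define ω(t) = sup{|g(x₁) - g(x₂)| : x₁, x₂ ∈ B(z,t)}, the oscillation of g on the ball B(z,t). Then for every r > 0, the integral ∫₀^r ω(t)²/t dt is finite. -/

import Mathlib

open MeasureTheory Metric Set

/-- `Dg` is the weak (distributional) differential of `g` on the plane. -/
def HasWeakFDeriv (g : ℂ → ℂ) (Dg : ℂ → ℂ →L[ℝ] ℂ) : Prop :=
  LocallyIntegrable g volume ∧
  LocallyIntegrable (fun x => ‖Dg x‖) volume ∧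
  ∀ φ : ℂ → ℝ, ContDiff ℝ (⊤ : ℕ∞) φ → HasCompactSupport φ → ∀ v : ℂ,
    ∫ x, φ x • Dg x v = - ∫ x, (fderiv ℝ φ x v) • g x

section AuxSection

open Filter Topology ENNReal

lemma aux_cs {α : Type*} [MeasurableSpace α] (μ : Measure α) {w F : α → ℝ≥0∞}
    (hw : AEMeasurable w μ) (hF : AEMeasurable F μ) :
    (∫⁻ a, w a * F a ∂μ) ^ 2 ≤ (∫⁻ a, w a ∂μ) * ∫⁻ a, w a * F a ^ 2 ∂μ := by
  have h := ENNReal.lintegral_mul_le_Lp_mul_Lq μ (p := 2) (q := 2)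
    Real.HolderConjugate.two_two (f := fun a => w a ^ (1/2 : ℝ))
    (g := fun a => w a ^ (1/2 : ℝ) * F a) (hw.pow_const _) ((hw.pow_const _).mul hF)
  have e0 : ∀ x : ℝ≥0∞, (x ^ (1/2 : ℝ)) ^ (2:ℝ) = x := fun x => by
    rw [← ENNReal.rpow_mul]; norm_num
  have e1 : ∀ x : ℝ≥0∞, (x ^ (1/2 : ℝ)) * (x ^ (1/2 : ℝ)) = x := fun x => by
    conv_rhs => rw [← e0 x]
    rw [ENNReal.rpow_two, sq]
  have e2 : ∀ x : ℝ≥0∞, (x ^ (1/2 : ℝ)) ^ 2 = x := fun x => by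
    rw [sq, e1]
  simp only [Pi.mul_apply, ← mul_assoc, e1, e0, ENNReal.mul_rpow_of_nonneg _ _ (by norm_num : (0:ℝ) ≤ 2)] at h
  calc _ ≤ _ := pow_le_pow_left' h 2
    _ = _ := by
      rw [mul_pow, e2, e2]
      simp only [ENNReal.rpow_two]

lemma aux_diam (g : ℂ ≃ₜ ℂ) (z : ℂ) {t : ℝ} (ht : 0 < t) :
    ∃ a ∈ sphere z t, ∃ b ∈ sphere z t, diam ((⇑g) '' ball z t) ≤ dist (g a) (g b) := by
  have hK : IsCompact (closedBall z t) := isCompact_closedBall z t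
  have hne : (closedBall z t ×ˢ closedBall z t).Nonempty :=
    ⟨(z, z), by simp [ht.le], by simp [ht.le]⟩
  obtain ⟨⟨p, q⟩, ⟨hp, hq⟩, hmax⟩ := (hK.prod hK).exists_isMaxOn hne
    (f := fun x : ℂ × ℂ => dist (g x.1) (g x.2)) (by fun_prop)
  simp only at hp hq
  have hmax' : ∀ x ∈ closedBall z t, ∀ y ∈ closedBall z t, dist (g x) (g y) ≤ dist (g p) (g q) :=
    fun x hx y hy => hmax (show (x, y) ∈ _ from ⟨hx, hy⟩)
  have hdiam : diam ((⇑g) '' ball z t) ≤ dist (g p) (g q) := by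
    refine diam_le_of_forall_dist_le dist_nonneg ?_
    rintro _ ⟨x, hx, rfl⟩ _ ⟨y, hy, rfl⟩
    exact hmax' x (ball_subset_closedBall hx) y (ball_subset_closedBall hy)
  -- key: if p is in the open ball and g p ≠ g q we can increase the distance
  have key : ∀ p q : ℂ, p ∈ ball z t → q ∈ closedBall z t → p ≠ q →
      ∃ x ∈ closedBall z t, dist (g p) (g q) < dist (g x) (g q) := by
    intro p q hp hq hpq
    have hne : g p ≠ g q := fun h => hpq (g.injective h)
    have hc : Tendsto (fun s : ℝ => g.symm (g p + (s : ℂ) * (g p - g q))) (𝓝[>] 0) (𝓝 p) := by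
      have : Continuous (fun s : ℝ => g.symm (g p + (s : ℂ) * (g p - g q))) := by fun_prop
      have h2 := this.tendsto 0
      simp only [Complex.ofReal_zero, zero_mul, add_zero, Homeomorph.symm_apply_apply] at h2
      exact h2.mono_left nhdsWithin_le_nhds
    obtain ⟨s, hs, hs0⟩ := ((hc.eventually (isOpen_ball.mem_nhds hp)).and
      self_mem_nhdsWithin).exists
    have hs0 : 0 < s := hs0
    refine ⟨_, ball_subset_closedBall hs, ?_⟩
    rw [Homeomorph.apply_symm_apply, dist_eq_norm, dist_eq_norm]
    have : g p + (s : ℂ) * (g p - g q) - g q = ((1 + s : ℝ) : ℂ) * (g p - g q) := by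
      push_cast; ring
    rw [this, norm_mul, Complex.norm_real, Real.norm_of_nonneg (by linarith)]
    have : 0 < ‖g p - g q‖ := norm_pos_iff.2 (sub_ne_zero.2 hne)
    nlinarith
  have hsph : ∀ x ∈ closedBall z t, x ∉ ball z t → x ∈ sphere z t := by
    intro x hx hx'
    simp only [mem_closedBall, mem_ball, mem_sphere, not_lt] at *
    exact le_antisymm hx hx'
  by_cases hpq : p = q
  · subst hpq
    refine ⟨z + t, by simp [ht.le], z + t, by simp [ht.le], ?_⟩
    simpa using hdiam
  · refine ⟨p, hsph p hp fun h => ?_, q, hsph q hq fun h => ?_, hdiam⟩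
    · obtain ⟨x, hx, hlt⟩ := key p q h hq hpq
      exact absurd (hmax' x hx q hq) (not_le.2 hlt)
    · obtain ⟨x, hx, hlt⟩ := key q p h hp (Ne.symm hpq)
      rw [dist_comm (g q), dist_comm (g x)] at hlt
      exact absurd (hmax' p hp x hx) (not_le.2 hlt)

lemma aux_circle (h : ℂ → ℂ) (hh : ContDiff ℝ 1 h) (z : ℂ) {t : ℝ} (ht : 0 < t)
    {a b : ℂ} (ha : a ∈ sphere z t) (hb : b ∈ sphere z t) :
    ‖h a - h b‖ₑ ^ 2 * ENNReal.ofReal t⁻¹ ≤ ENNReal.ofReal (2 * Real.pi) *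
      (ENNReal.ofReal t * ∫⁻ θ in Ioo (-Real.pi) Real.pi, ‖fderiv ℝ h (circleMap z t θ)‖ₑ ^ 2) := by
  have hpar : ∀ x ∈ sphere z t, ∃ θ ∈ Icc (-Real.pi) Real.pi, circleMap z t θ = x := by
    intro x hx
    refine ⟨Complex.arg (x - z), ⟨(Complex.neg_pi_lt_arg _).le, Complex.arg_le_pi _⟩, ?_⟩
    have : ‖x - z‖ = t := by rw [← dist_eq_norm]; exact hx
    have h2 := Complex.norm_mul_exp_arg_mul_I (x - z)
    rw [this] at h2
    rw [circleMap, h2]; ring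
  have hcm : ∀ n, ContDiff ℝ n (circleMap z t) := fun n => contDiff_circleMap z t
  have hcomp : ContDiff ℝ 1 (fun θ => h (circleMap z t θ)) := hh.comp (hcm 1)
  have hder : ∀ θ, ‖deriv (fun θ => h (circleMap z t θ)) θ‖ₑ ≤
      ENNReal.ofReal t * ‖fderiv ℝ h (circleMap z t θ)‖ₑ := by
    intro θ
    have h1 := ((hh.differentiable one_ne_zero (circleMap z t θ)).hasFDerivAt).comp_hasDerivAt θ
      (hasDerivAt_circleMap z t θ)
    have h1' : deriv (fun θ => h (circleMap z t θ)) θ = _ := h1.deriv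
    rw [h1']
    refine (ContinuousLinearMap.le_opENorm _ _).trans ?_
    rw [mul_comm]
    gcongr
    rw [← ofReal_norm]
    gcongr
    simp [abs_of_pos ht]
  set N : ℝ → ℝ≥0∞ := fun θ => ‖fderiv ℝ h (circleMap z t θ)‖ₑ with hN
  have hNc : Continuous N := by
    have := hh.continuous_fderiv one_ne_zero
    have h2 := (hcm 0).continuous
    fun_prop
  have key : ∀ α ∈ Icc (-Real.pi) Real.pi, ∀ β ∈ Icc (-Real.pi) Real.pi, α ≤ β →
      ‖h (circleMap z t β) - h (circleMap z t α)‖ₑ ≤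
        ∫⁻ θ in Ioo (-Real.pi) Real.pi, ENNReal.ofReal t * N θ := by
    intro α hα β hβ hab
    refine (enorm_sub_le_lintegral_deriv_of_contDiffOn_Icc hcomp.contDiffOn hab).trans ?_
    rw [restrict_Ioo_eq_restrict_Icc]
    refine (lintegral_mono fun θ => hder θ).trans ?_
    exact lintegral_mono_set (Icc_subset_Icc hα.1 hβ.2)
  obtain ⟨α, hα, rfl⟩ := hpar a ha
  obtain ⟨β, hβ, rfl⟩ := hpar b hb
  have key2 : ‖h (circleMap z t α) - h (circleMap z t β)‖ₑ ≤
        ∫⁻ θ in Ioo (-Real.pi) Real.pi, ENNReal.ofReal t * N θ := by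
    rcases le_total α β with hab | hab
    · rw [← enorm_neg, neg_sub]; exact key α hα β hβ hab
    · exact key β hβ α hα hab
  have cs := aux_cs (volume.restrict (Ioo (-Real.pi) Real.pi)) (w := fun _ => 1) (F := N)
    aemeasurable_const hNc.measurable.aemeasurable
  simp only [one_mul, lintegral_const, Measure.restrict_apply_univ, Real.volume_Ioo] at cs
  rw [lintegral_const_mul _ hNc.measurable] at key2
  have htt : ENNReal.ofReal t * ENNReal.ofReal t⁻¹ = 1 := by
    rw [← ENNReal.ofReal_mul ht.le, mul_inv_cancel₀ ht.ne', ENNReal.ofReal_one]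
  calc _ ≤ (ENNReal.ofReal t * ∫⁻ θ in Ioo (-Real.pi) Real.pi, N θ) ^ 2 * ENNReal.ofReal t⁻¹ := by
        gcongr
    _ = (ENNReal.ofReal t * ENNReal.ofReal t⁻¹) * (ENNReal.ofReal t *
          (∫⁻ θ in Ioo (-Real.pi) Real.pi, N θ) ^ 2) := by ring
    _ ≤ 1 * (ENNReal.ofReal t * (ENNReal.ofReal (Real.pi - -Real.pi) *
          ∫⁻ θ in Ioo (-Real.pi) Real.pi, N θ ^ 2)) := by
        rw [htt]; gcongr
    _ = _ := by
        rw [show Real.pi - -Real.pi = 2 * Real.pi by ring]; ring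

lemma aux_polar (H : ℂ → ℝ≥0∞) (hH : Measurable H) (z : ℂ) (r : ℝ) :
    ∫⁻ t in Ioo 0 r, ENNReal.ofReal t * ∫⁻ θ in Ioo (-Real.pi) Real.pi, H (circleMap z t θ)
      ≤ ∫⁻ x in ball z r, H x := by
  have h1 : ∫⁻ x in ball z r, H x = ∫⁻ x, (ball z r).indicator H (z + x) := by
    rw [lintegral_add_left_eq_self (fun x => (ball z r).indicator H x) z,
      lintegral_indicator measurableSet_ball]
  have hm : Measurable fun p : ℝ × ℝ => circleMap z p.1 p.2 := by
    unfold circleMap; fun_prop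
  rw [h1, ← Complex.lintegral_comp_polarCoord_symm, polarCoord_target, Measure.volume_eq_prod,
    ← Measure.prod_restrict]
  have h2 : ∀ p : ℝ × ℝ, z + Complex.polarCoord.symm p = circleMap z p.1 p.2 := by
    intro p
    rw [Complex.polarCoord_symm_apply, circleMap, Complex.exp_mul_I]
    simp
  simp only [h2, smul_eq_mul]
  have hmi : Measurable fun p : ℝ × ℝ => (ball z r).indicator H (circleMap z p.1 p.2) :=
    (hH.indicator measurableSet_ball).comp hm
  rw [lintegral_prod _ (by fun_prop)]
  refine le_trans ?_ (lintegral_mono_set (Ioo_subset_Ioi_self : Ioo 0 r ⊆ Ioi 0))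
  refine setLIntegral_mono' measurableSet_Ioo fun t ht => ?_
  have hmt : Measurable fun θ : ℝ => H (circleMap z t θ) :=
    hH.comp (hm.comp (measurable_prodMk_left (x := t)))
  rw [← lintegral_const_mul _ hmt]
  refine lintegral_mono fun θ => ?_
  simp only
  rw [indicator_of_mem]
  rw [mem_ball, dist_eq_norm]
  simp [circleMap, abs_of_pos ht.1, ht.2]

lemma aux_deriv_bound (g : ℂ → ℂ) (Dg : ℂ → ℂ →L[ℝ] ℂ) (hweak : HasWeakFDeriv g Dg)
    (φ : ContDiffBump (0 : ℂ)) (x : ℂ) :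
    ‖fderiv ℝ (convolution (φ.normed volume) g (ContinuousLinearMap.lsmul ℝ ℝ) volume) x‖ₑ ≤
      ∫⁻ y, ENNReal.ofReal (φ.normed volume (x - y)) * ‖Dg y‖ₑ := by
  obtain ⟨hg, hD, hw⟩ := hweak
  set η : ℂ → ℝ := φ.normed volume with hη
  have hηs : ∀ n : ℕ∞, ContDiff ℝ n η := fun n => φ.contDiff_normed
  have hηc : HasCompactSupport η := φ.hasCompactSupport_normed
  have hder := (hηc.hasFDerivAt_convolution_left (ContinuousLinearMap.lsmul ℝ ℝ)
    (hηs 1) hg x).fderiv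
  -- reflected function
  set ψ : ℂ → ℝ := fun y => η (x - y) with hψ
  have hψs : ContDiff ℝ (⊤ : ℕ∞) ψ := (hηs ⊤).comp (contDiff_const.sub contDiff_id)
  have hψc : HasCompactSupport ψ :=
    hηc.comp_homeomorph (Homeomorph.subLeft x)
  have hψd : ∀ y v, fderiv ℝ ψ y v = - fderiv ℝ η (x - y) v := by
    intro y v
    have h1 := (((hηs 1).differentiable one_ne_zero (x - y)).hasFDerivAt).comp y
      ((hasFDerivAt_id (𝕜 := ℝ) y).const_sub x)
    have h1' : fderiv ℝ ψ y = _ := h1.fderiv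
    rw [h1']; simp
  have hint : Integrable (fun y => ψ y * ‖Dg y‖) volume := by
    have := hD.integrable_smul_left_of_hasCompactSupport hψs.continuous hψc
    simpa using this
  have hψ0 : ∀ y, 0 ≤ ψ y := fun y => φ.nonneg_normed _
  have hbound : ‖fderiv ℝ (convolution η g (ContinuousLinearMap.lsmul ℝ ℝ) volume) x‖ ≤
      ∫ y, ψ y * ‖Dg y‖ := by
    refine ContinuousLinearMap.opNorm_le_bound _
      (integral_nonneg fun y => mul_nonneg (hψ0 y) (norm_nonneg _)) fun v => ?_
    have e : fderiv ℝ (convolution η g (ContinuousLinearMap.lsmul ℝ ℝ) volume) x v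
        = ∫ y, ψ y • Dg y v := by
      rw [hder, hw ψ hψs hψc v, ← integral_neg, convolution_eq_swap,
        ContinuousLinearMap.integral_apply]
      · refine integral_congr_ae (Eventually.of_forall fun y => ?_)
        simp [hψd, ContinuousLinearMap.precompL_apply]
      · have hce := (hηc.fderiv ℝ).convolutionExists_left
          ((ContinuousLinearMap.lsmul ℝ ℝ : ℝ →L[ℝ] ℂ →L[ℝ] ℂ).precompL ℂ)
          ((hηs 1).continuous_fderiv one_ne_zero) hg x
        exact hce.integrable_swap
    rw [e, ← integral_mul_const]
    refine norm_integral_le_of_norm_le (hint.mul_const _) (Eventually.of_forall fun y => ?_)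
    rw [norm_smul, Real.norm_of_nonneg (hψ0 y), mul_assoc]
    exact mul_le_mul_of_nonneg_left ((Dg y).le_opNorm v) (hψ0 y)
  rw [← ofReal_norm]
  refine (ENNReal.ofReal_le_ofReal hbound).trans ?_
  rw [ofReal_integral_eq_lintegral_ofReal hint
    (Eventually.of_forall fun y => mul_nonneg (hψ0 y) (norm_nonneg _))]
  refine lintegral_mono fun y => ?_
  rw [ENNReal.ofReal_mul (hψ0 y), ofReal_norm]

lemma aux_energy (g : ℂ → ℂ) (Dg : ℂ → ℂ →L[ℝ] ℂ) (hweak : HasWeakFDeriv g Dg)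
    (φ : ContDiffBump (0 : ℂ)) (hφ : φ.rOut ≤ 1) (z : ℂ) (r : ℝ) :
    ∫⁻ x in ball z r,
      ‖fderiv ℝ (convolution (φ.normed volume) g (ContinuousLinearMap.lsmul ℝ ℝ) volume) x‖ₑ ^ 2
      ≤ ∫⁻ y in ball z (r + 1), ‖Dg y‖ₑ ^ 2 := by
  have hDm : AEMeasurable (fun y => ‖Dg y‖ₑ) volume := by
    have := hweak.2.1.aestronglyMeasurable.aemeasurable.ennreal_ofReal
    simpa only [ofReal_norm] using this
  set η : ℂ → ℝ := φ.normed volume with hη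
  have hηcont : Continuous η := (φ.contDiff_normed (n := 0)).continuous
  have hη1 : ∫⁻ y, ENNReal.ofReal (η y) = 1 := by
    rw [← ofReal_integral_eq_lintegral_ofReal φ.integrable_normed
      (Eventually.of_forall fun y => φ.nonneg_normed y), φ.integral_normed, ENNReal.ofReal_one]
  have step1 : ∀ x,
      ‖fderiv ℝ (convolution η g (ContinuousLinearMap.lsmul ℝ ℝ) volume) x‖ₑ ^ 2 ≤
      ∫⁻ y, ENNReal.ofReal (η (x - y)) * ‖Dg y‖ₑ ^ 2 := by
    intro x
    refine (pow_le_pow_left' (aux_deriv_bound g Dg hweak φ x) 2).trans ?_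
    refine (aux_cs volume (w := fun y => ENNReal.ofReal (η (x - y))) (by fun_prop) hDm).trans ?_
    rw [lintegral_sub_left_eq_self (fun y => ENNReal.ofReal (η y)) x, hη1, one_mul]
  refine (lintegral_mono step1).trans ?_
  rw [lintegral_lintegral_swap]
  · rw [← lintegral_indicator measurableSet_ball]
    refine lintegral_mono fun y => ?_
    simp only
    by_cases hy : y ∈ ball z (r + 1)
    · rw [indicator_of_mem hy]
      rw [lintegral_mul_const _ (by fun_prop)]
      refine (mul_le_mul_left (setLIntegral_le_lintegral _ _) _).trans ?_
      rw [lintegral_sub_right_eq_self (fun y => ENNReal.ofReal (η y)) y, hη1, one_mul]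
    · rw [indicator_of_notMem hy, nonpos_iff_eq_zero]
      rw [setLIntegral_eq_zero measurableSet_ball]
      intro x hx
      have : η (x - y) = 0 := by
        by_contra hne
        have h1 : x - y ∈ Function.support η := hne
        rw [hη, φ.support_normed_eq, mem_ball_zero_iff] at h1
        apply hy
        rw [mem_ball] at hx ⊢
        have h3 : dist x y < φ.rOut := by rw [dist_eq_norm]; exact h1
        have := dist_triangle_left y z x
        linarith
      simp [this]
  · have : AEMeasurable (fun p : ℂ × ℂ => ‖Dg p.2‖ₑ) ((volume.restrict (ball z r)).prod volume) :=
      hDm.comp_snd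
    have h2 : Measurable fun p : ℂ × ℂ => ENNReal.ofReal (η (p.1 - p.2)) := by fun_prop
    exact h2.aemeasurable.mul (this.pow_const 2)

end AuxSection

/-- A planar homeomorphism of Sobolev class `W^{1,2}_loc` satisfies
`∫₀^r ω(t)²/t dt < ∞`, where `ω(t)` is the oscillation of `g` on `B(z,t)`. -/
theorem sobolev_homeo_dini_oscillation (g : ℂ ≃ₜ ℂ) (Dg : ℂ → ℂ →L[ℝ] ℂ)
    (hweak : HasWeakFDeriv (⇑g) Dg)
    (hL2loc : ∀ R : ℝ, IntegrableOn (fun x => ‖Dg x‖ ^ 2) (ball (0 : ℂ) R) volume)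
    (z : ℂ) (r : ℝ) (hr : 0 < r) :
    IntegrableOn (fun t => (diam ((⇑g) '' ball z t)) ^ 2 / t) (Ioo (0 : ℝ) r) volume := by
  have hmono : Monotone fun t : ℝ => diam ((⇑g) '' ball z t) := by
    intro s t hst
    refine diam_mono (image_mono (ball_subset_ball hst)) ?_
    exact (((isCompact_closedBall z t).image g.continuous).isBounded).subset
      (image_mono ball_subset_closedBall)
  have hmeas : Measurable fun t : ℝ => (diam ((⇑g) '' ball z t)) ^ 2 / t :=
    (hmono.measurable.pow_const 2).div measurable_id
  refine ⟨hmeas.aestronglyMeasurable, ?_⟩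
  -- the energy is finite
  have hE : ∫⁻ y in ball z (r + 1), ‖Dg y‖ₑ ^ 2 < ⊤ := by
    have h1 := (hL2loc (‖z‖ + (r + 1))).2
    refine lt_of_le_of_lt (lintegral_mono_set (t := ball 0 (‖z‖ + (r + 1))) ?_) ?_
    · refine ball_subset_ball' ?_
      rw [dist_zero_right]; linarith
    · rw [hasFiniteIntegral_iff_enorm] at h1
      simpa using h1
  -- mollifiers
  let φ : ℕ → ContDiffBump (0 : ℂ) := fun n =>
    ⟨1 / ((n : ℝ) + 2), 1 / ((n : ℝ) + 1), by positivity,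
      one_div_lt_one_div_of_lt (by positivity) (by linarith)⟩
  have hφ0 : Filter.Tendsto (fun n => (φ n).rOut) Filter.atTop (nhds 0) :=
    tendsto_one_div_add_atTop_nhds_zero_nat
  have hφ1 : ∀ n, (φ n).rOut ≤ 1 := fun n => by
    show 1 / ((n : ℝ) + 1) ≤ 1
    rw [div_le_one (by positivity)]
    have : (0:ℝ) ≤ n := n.cast_nonneg
    linarith
  let h : ℕ → ℂ → ℂ := fun n =>
    convolution ((φ n).normed volume) g (ContinuousLinearMap.lsmul ℝ ℝ) volume
  have hhs : ∀ n, ContDiff ℝ 1 (h n) := fun n =>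
    (φ n).hasCompactSupport_normed.contDiff_convolution_left (n := 1) _
      (φ n).contDiff_normed hweak.1
  have hht : ∀ x, Filter.Tendsto (fun n => h n x) Filter.atTop (nhds (g x)) := fun x =>
    ContDiffBump.convolution_tendsto_right_of_continuous hφ0 g.continuous x
  let G : ℕ → ℝ → ENNReal := fun n t => ENNReal.ofReal (2 * Real.pi) *
    (ENNReal.ofReal t * ∫⁻ θ in Ioo (-Real.pi) Real.pi, ‖fderiv ℝ (h n) (circleMap z t θ)‖ₑ ^ 2)
  have hHm : ∀ n, Measurable fun x => ‖fderiv ℝ (h n) x‖ₑ ^ 2 := fun n => by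
    have := ((hhs n).continuous_fderiv one_ne_zero)
    exact (this.enorm.measurable).pow_const 2
  have hin : ∀ n, Measurable fun t : ℝ =>
      ENNReal.ofReal t * ∫⁻ θ in Ioo (-Real.pi) Real.pi, ‖fderiv ℝ (h n) (circleMap z t θ)‖ₑ ^ 2 := by
    intro n
    refine ENNReal.measurable_ofReal.mul ?_
    have hm : Measurable fun p : ℝ × ℝ => circleMap z p.1 p.2 := by
      unfold circleMap; fun_prop
    exact Measurable.lintegral_prod_right' ((hHm n).comp hm)
  have hGm : ∀ n, Measurable (G n) := fun n => (hin n).const_mul _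
  have hGint : ∀ n, ∫⁻ t in Ioo 0 r, G n t ≤
      ENNReal.ofReal (2 * Real.pi) * ∫⁻ y in ball z (r + 1), ‖Dg y‖ₑ ^ 2 := by
    intro n
    simp only [G]
    rw [lintegral_const_mul _ (hin n)]
    gcongr
    exact (aux_polar _ (hHm n) z r).trans (aux_energy g Dg hweak (φ n) (hφ1 n) z r)
  have hpt : ∀ t ∈ Ioo 0 r, ‖(diam ((⇑g) '' ball z t)) ^ 2 / t‖ₑ ≤
      Filter.liminf (fun n => G n t) Filter.atTop := by
    intro t ht
    obtain ⟨a, ha, b, hb, hab⟩ := aux_diam g z ht.1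
    have h1 : ‖(diam ((⇑g) '' ball z t)) ^ 2 / t‖ₑ ≤ ‖g a - g b‖ₑ ^ 2 * ENNReal.ofReal t⁻¹ := by
      rw [← ofReal_norm, Real.norm_of_nonneg (div_nonneg (sq_nonneg _) ht.1.le), ← ofReal_norm,
        ← ENNReal.ofReal_pow (norm_nonneg _), ← ENNReal.ofReal_mul (by positivity),
        div_eq_mul_inv]
      have : 0 ≤ t⁻¹ := inv_nonneg.2 ht.1.le
      rw [dist_eq_norm] at hab
      have : 0 ≤ diam ((⇑g) '' ball z t) := diam_nonneg
      gcongr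
    have h2 : Filter.Tendsto (fun n => ‖h n a - h n b‖ₑ ^ 2 * ENNReal.ofReal t⁻¹) Filter.atTop
        (nhds (‖g a - g b‖ₑ ^ 2 * ENNReal.ofReal t⁻¹)) := by
      refine ENNReal.Tendsto.mul_const ?_ (Or.inr ENNReal.ofReal_ne_top)
      exact ((ENNReal.continuous_pow 2).tendsto _).comp (((hht a).sub (hht b)).enorm)
    refine h1.trans ?_
    rw [← h2.liminf_eq]
    exact Filter.liminf_le_liminf
      (Filter.Eventually.of_forall fun n => aux_circle (h n) (hhs n) z ht.1 ha hb)
  rw [hasFiniteIntegral_iff_enorm]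
  calc _ ≤ ∫⁻ t in Ioo 0 r, Filter.liminf (fun n => G n t) Filter.atTop :=
        setLIntegral_mono' measurableSet_Ioo hpt
    _ ≤ Filter.liminf (fun n => ∫⁻ t in Ioo 0 r, G n t) Filter.atTop := lintegral_liminf_le hGm
    _ ≤ ENNReal.ofReal (2 * Real.pi) * ∫⁻ y in ball z (r + 1), ‖Dg y‖ₑ ^ 2 := by
        refine Filter.liminf_le_of_frequently_le' ?_
        exact Filter.Frequently.of_forall hGint
    _ < ⊤ := ENNReal.mul_lt_top ENNReal.ofReal_lt_top hE
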